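/- arXiv:2110.11705 — 2 statements merged into one kernel-verified Lean document; each statement's English description precedes it below -/
import Mathlib

section
/- Let Φ : B(K) → B(H) be a Stinespring-form operation, and define ⟨⟨A|B⟩⟩ := Φ(A*B) − Φ(A*)Φ(B). Then for all A, B ∈ B(K): ‖[Φ(A), Φ(B)] − Φ([A,B])‖ ≤ ‖⟨⟨A|A⟩⟩‖^{1/2} ‖⟨⟨B*|B*⟩⟩‖^{1/2} + ‖⟨⟨A*|A*⟩⟩‖^{1/2} ‖⟨⟨B|B⟩⟩‖^{1/2}. -/
open ContinuousLinearMap in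
/-- If `V` is a contraction, then `1 - V V*` has the form `S* S`. -/
theorem exists_one_sub_comp_adjoint_eq {H M : Type*}
    [NormedAddCommGroup H] [InnerProductSpace ℂ H] [CompleteSpace H]
    [NormedAddCommGroup M] [InnerProductSpace ℂ M] [CompleteSpace M]
    (V : H →L[ℂ] M) (hV : ‖V‖ ≤ 1) :
    ∃ S : M →L[ℂ] M, 1 - V ∘L adjoint V = adjoint S ∘L S := by
  have hpos : 0 ≤ V ∘L adjoint V := by
    rw [nonneg_iff_isPositive]
    exact isPositive_self_comp_adjoint V
  have hnorm : ‖V ∘L adjoint V‖ ≤ 1 :=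
    (opNorm_comp_le _ _).trans
      (mul_le_one₀ hV (norm_nonneg _) (by rwa [LinearIsometryEquiv.norm_map]))
  have hle : 0 ≤ 1 - V ∘L adjoint V :=
    sub_nonneg.2 ((CStarAlgebra.norm_le_one_iff_of_nonneg _ hpos).1 hnorm)
  obtain ⟨S, hS⟩ := CStarAlgebra.nonneg_iff_eq_star_mul_self.1 hle
  exact ⟨S, hS⟩

open ContinuousLinearMap in
/-- Cauchy–Schwarz inequality for the defect `Φ(A B) - Φ(A) Φ(B)` of a Stinespring-form
operation. -/
theorem norm_stinespring_defect_le {H K M : Type*}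
    [NormedAddCommGroup H] [InnerProductSpace ℂ H] [CompleteSpace H]
    [NormedAddCommGroup K] [InnerProductSpace ℂ K] [CompleteSpace K]
    [NormedAddCommGroup M] [InnerProductSpace ℂ M] [CompleteSpace M]
    (π : (K →L[ℂ] K) →⋆ₐ[ℂ] (M →L[ℂ] M))
    (V : H →L[ℂ] M) (hV : ‖V‖ ≤ 1)
    (Φ : (K →L[ℂ] K) → (H →L[ℂ] H))
    (hΦ : ∀ A, Φ A = (adjoint V).comp ((π A).comp V))
    (A B : K →L[ℂ] K) :
    ‖Φ (A * B) - Φ A * Φ B‖ ≤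
      Real.sqrt ‖Φ (A * star A) - Φ A * Φ (star A)‖ *
        Real.sqrt ‖Φ (star B * B) - Φ (star B) * Φ B‖ := by
  obtain ⟨S, hS⟩ := exists_one_sub_comp_adjoint_eq V hV
  have key (C D : K →L[ℂ] K) : Φ (C * D) - Φ C * Φ D =
      adjoint (S ∘L π (star C) ∘L V) ∘L (S ∘L π D ∘L V) := by
    have h : Φ (C * D) - Φ C * Φ D =
        adjoint V ∘L π C ∘L (1 - V ∘L adjoint V) ∘L π D ∘L V := by
      ext x
      simp [hΦ]
    rw [h, hS, map_star, star_eq_adjoint]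
    simp only [adjoint_comp, adjoint_adjoint, comp_assoc]
  have hA := key A (star A)
  have hB := key (star B) B
  rw [star_star] at hB
  rw [key A B, hA, hB, norm_adjoint_comp_self, norm_adjoint_comp_self,
    Real.sqrt_mul_self (norm_nonneg _), Real.sqrt_mul_self (norm_nonneg _)]
  exact (opNorm_comp_le _ _).trans_eq (by rw [LinearIsometryEquiv.norm_map])


/-- Norm bound on the deviation of a Stinespring-form operation from being a
commutator homomorphism, in terms of the sesquilinear defects
`⟨⟨A|B⟩⟩ := Φ(A*B) − Φ(A*)Φ(B)`. -/
theorem stmt_2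
    {H K M : Type*}
    [NormedAddCommGroup H] [InnerProductSpace ℂ H] [CompleteSpace H]
    [NormedAddCommGroup K] [InnerProductSpace ℂ K] [CompleteSpace K]
    [NormedAddCommGroup M] [InnerProductSpace ℂ M] [CompleteSpace M]
    (π : (K →L[ℂ] K) →⋆ₐ[ℂ] (M →L[ℂ] M))
    (V : H →L[ℂ] M) (hV : ‖V‖ ≤ 1)
    (Φ : (K →L[ℂ] K) → (H →L[ℂ] H))
    (hΦ : ∀ A, Φ A = (ContinuousLinearMap.adjoint V).comp ((π A).comp V))
    (A B : K →L[ℂ] K) :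
    ‖(Φ A * Φ B - Φ B * Φ A) - Φ (A * B - B * A)‖ ≤
      Real.sqrt ‖Φ (star A * A) - Φ (star A) * Φ A‖ *
        Real.sqrt ‖Φ (B * star B) - Φ B * Φ (star B)‖ +
      Real.sqrt ‖Φ (A * star A) - Φ A * Φ (star A)‖ *
        Real.sqrt ‖Φ (star B * B) - Φ (star B) * Φ B‖ := by
  have hsub : Φ (A * B - B * A) = Φ (A * B) - Φ (B * A) := by
    ext x
    simp [hΦ]
  have hAB := norm_stinespring_defect_le π V hV Φ hΦ A B
  have hBA := norm_stinespring_defect_le π V hV Φ hΦ B A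
  calc ‖(Φ A * Φ B - Φ B * Φ A) - Φ (A * B - B * A)‖
      = ‖(Φ (B * A) - Φ B * Φ A) - (Φ (A * B) - Φ A * Φ B)‖ := by
        rw [hsub]
        congr 1
        abel
    _ ≤ ‖Φ (B * A) - Φ B * Φ A‖ + ‖Φ (A * B) - Φ A * Φ B‖ := norm_sub_le _ _
    _ ≤ _ := add_le_add (hBA.trans_eq (mul_comm _ _)) hAB
end

section
/- Let Φ : B(K) → B(H) be a unital Stinespring-form operation (V*V = 1). Let a, b ∈ B(K) be effects with ab = ba, let F ∈ B(H) be an effect, and set δ := Φ(b) − F. Then ‖[Φ(a), F]‖ ≤ ‖δ‖ + 2 ‖Φ(a) − Φ(a)²‖^{1/2} · ( 2‖δ‖ + ‖F − F²‖ )^{1/2}. -/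
open ContinuousLinearMap in
/-- Covariance identity for the compression `V† · V` of operators on `M` to `H`. -/
theorem adjoint_defect_comp_defect
    {H M : Type*}
    [NormedAddCommGroup H] [InnerProductSpace ℂ H] [CompleteSpace H]
    [NormedAddCommGroup M] [InnerProductSpace ℂ M] [CompleteSpace M]
    (V : H →L[ℂ] M) (hV : (adjoint V).comp V = 1) (A B : M →L[ℂ] M) (hA : adjoint A = A) :
    (adjoint (A.comp V - V.comp ((adjoint V).comp (A.comp V)))).comp
        (B.comp V - V.comp ((adjoint V).comp (B.comp V))) =
      (adjoint V).comp ((A * B).comp V) -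
        ((adjoint V).comp (A.comp V)) * ((adjoint V).comp (B.comp V)) := by
  have h (x : H) : adjoint V (V x) = x := by
    simpa using DFunLike.congr_fun hV x
  ext x
  simp [adjoint_comp, hA, h]

/-- An effect `x` satisfies `x ^ 2 ≤ x`. -/
theorem mul_self_le_self_of_effect {R : Type*} [Ring R] [StarRing R] [PartialOrder R]
    [StarOrderedRing R] {x : R} (h0 : 0 ≤ x) (h1 : x ≤ 1) : x * x ≤ x := by
  have hs : IsSelfAdjoint x := .of_nonneg h0
  have hs' : IsSelfAdjoint (1 - x) := .of_nonneg (sub_nonneg.2 h1)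
  rw [← sub_nonneg]
  have h := add_nonneg (hs.conjugate_nonneg (sub_nonneg.2 h1)) (hs'.conjugate_nonneg h0)
  convert h using 1
  noncomm_ring

/-- The commutator with an effect has norm at most one. -/
theorem norm_commutator_le_of_effect {R : Type*} [CStarAlgebra R] [PartialOrder R]
    [StarOrderedRing R] {x : R} (h0 : 0 ≤ x) (h1 : x ≤ 1) (y : R) :
    ‖x * y - y * x‖ ≤ ‖y‖ := by
  have hs : IsSelfAdjoint x := .of_nonneg h0
  have hr : IsSelfAdjoint (x - (1 - x)) := hs.sub ((IsSelfAdjoint.one R).sub hs)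
  have hsq : ‖(x - (1 - x)) * (x - (1 - x))‖ ≤ 1 := by
    refine CStarAlgebra.norm_le_one_iff_of_nonneg _ (hr.mul_self_nonneg) |>.2 ?_
    have h := mul_self_le_self_of_effect h0 h1
    rw [← sub_nonneg] at h ⊢
    have h4 := nsmul_nonneg h 4
    convert h4 using 1
    noncomm_ring
  have hn : ‖x - (1 - x)‖ ≤ 1 := by
    rw [hr.norm_mul_self] at hsq
    nlinarith [norm_nonneg (x - (1 - x))]
  have key : (2 : ℝ) * ‖x * y - y * x‖ ≤ 2 * ‖y‖ := by
    calc (2 : ℝ) * ‖x * y - y * x‖ = ‖(2 : ℝ) • (x * y - y * x)‖ := by simp [norm_smul]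
      _ = ‖(x - (1 - x)) * y - y * (x - (1 - x))‖ := by
        rw [two_smul]
        congr 1
        noncomm_ring
      _ ≤ ‖x - (1 - x)‖ * ‖y‖ + ‖y‖ * ‖x - (1 - x)‖ :=
        (norm_sub_le _ _).trans (add_le_add (norm_mul_le _ _) (norm_mul_le _ _))
      _ ≤ 2 * ‖y‖ := by nlinarith [norm_nonneg y]
  linarith

open ContinuousLinearMap in
/-- The defect of a compressed effect is controlled by the unsharpness of the compression. -/
theorem norm_defect_sq_le
    {H M : Type*}
    [NormedAddCommGroup H] [InnerProductSpace ℂ H] [CompleteSpace H]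
    [NormedAddCommGroup M] [InnerProductSpace ℂ M] [CompleteSpace M]
    (V : H →L[ℂ] M) (hV : (adjoint V).comp V = 1) {A : M →L[ℂ] M} (h0 : 0 ≤ A) (h1 : A ≤ 1) :
    ‖A.comp V - V.comp ((adjoint V).comp (A.comp V))‖ ≤
      √‖(adjoint V).comp (A.comp V) -
        ((adjoint V).comp (A.comp V)) * ((adjoint V).comp (A.comp V))‖ := by
  have hA : adjoint A = A := IsSelfAdjoint.of_nonneg h0
  refine Real.le_sqrt_of_sq_le ?_
  rw [sq, ← norm_adjoint_comp_self]
  refine CStarAlgebra.norm_le_norm_of_nonneg_of_le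
    (a := (adjoint _).comp (A.comp V - V.comp ((adjoint V).comp (A.comp V)))) ?_ ?_
  · rw [nonneg_iff_isPositive]
    exact isPositive_adjoint_comp_self _
  · rw [adjoint_defect_comp_defect V hV A A hA]
    refine sub_le_sub_right ?_ _
    have h := (sub_nonneg.2 (mul_self_le_self_of_effect h0 h1))
    rw [nonneg_iff_isPositive] at h
    rw [← sub_nonneg, nonneg_iff_isPositive]
    simpa only [sub_comp, comp_sub] using h.adjoint_conj V

/-- Quantitative disturbance bound in terms of the disturbance and the intrinsic
unsharpness of the non-disturbed effect `F`. -/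
theorem stmt_12
    {H K M : Type*}
    [NormedAddCommGroup H] [InnerProductSpace ℂ H] [CompleteSpace H]
    [NormedAddCommGroup K] [InnerProductSpace ℂ K] [CompleteSpace K]
    [NormedAddCommGroup M] [InnerProductSpace ℂ M] [CompleteSpace M]
    (π : (K →L[ℂ] K) →⋆ₐ[ℂ] (M →L[ℂ] M))
    (V : H →L[ℂ] M) (hV : ‖V‖ ≤ 1)
    (hunital : (ContinuousLinearMap.adjoint V).comp V = 1)
    (Φ : (K →L[ℂ] K) → (H →L[ℂ] H))
    (hΦ : ∀ A, Φ A = (ContinuousLinearMap.adjoint V).comp ((π A).comp V))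
    (a b : K →L[ℂ] K) (ha0 : 0 ≤ a) (ha1 : a ≤ 1) (hb0 : 0 ≤ b) (hb1 : b ≤ 1)
    (hab : a * b = b * a)
    (F : H →L[ℂ] H) (hF0 : 0 ≤ F) (hF1 : F ≤ 1) :
    ‖Φ a * F - F * Φ a‖ ≤
      ‖Φ b - F‖ +
        2 * (Real.sqrt ‖Φ a - Φ a * Φ a‖ *
          Real.sqrt (2 * ‖Φ b - F‖ + ‖F - F * F‖)) := by
  set D : (M →L[ℂ] M) → (H →L[ℂ] M) := fun A ↦
    A.comp V - V.comp ((ContinuousLinearMap.adjoint V).comp (A.comp V)) with hD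
  have map_effect {c : K →L[ℂ] K} (h0 : 0 ≤ c) (h1 : c ≤ 1) : 0 ≤ π c ∧ π c ≤ 1 := by
    refine ⟨map_nonneg π h0, ?_⟩
    have h := map_nonneg π (sub_nonneg.2 h1)
    rwa [map_sub, map_one, sub_nonneg] at h
  have Φ_effect {c : K →L[ℂ] K} (h0 : 0 ≤ c) (h1 : c ≤ 1) : 0 ≤ Φ c ∧ Φ c ≤ 1 := by
    obtain ⟨h0, h1⟩ := map_effect h0 h1
    constructor
    · rw [ContinuousLinearMap.nonneg_iff_isPositive] at h0 ⊢
      rw [hΦ]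
      exact h0.adjoint_conj V
    · have h := (ContinuousLinearMap.nonneg_iff_isPositive _).1 (sub_nonneg.2 h1)
      rw [← sub_nonneg, ContinuousLinearMap.nonneg_iff_isPositive, hΦ, ← hunital]
      simpa only [ContinuousLinearMap.sub_comp, ContinuousLinearMap.comp_sub,
        ContinuousLinearMap.one_def, ContinuousLinearMap.id_comp] using h.adjoint_conj V
  obtain ⟨hA0, hA1⟩ := map_effect ha0 ha1
  obtain ⟨hB0, hB1⟩ := map_effect hb0 hb1
  obtain ⟨hΦa0, hΦa1⟩ := Φ_effect ha0 ha1
  obtain ⟨hΦb0, hΦb1⟩ := Φ_effect hb0 hb1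
  have hAB := adjoint_defect_comp_defect V hunital (π a) (π b) (IsSelfAdjoint.of_nonneg hA0)
  have hBA := adjoint_defect_comp_defect V hunital (π b) (π a) (IsSelfAdjoint.of_nonneg hB0)
  have hDa : ‖D (π a)‖ ≤ √‖Φ a - Φ a * Φ a‖ := by
    rw [hΦ]
    exact norm_defect_sq_le V hunital hA0 hA1
  have hDb : ‖D (π b)‖ ≤ √‖Φ b - Φ b * Φ b‖ := by
    rw [hΦ]
    exact norm_defect_sq_le V hunital hB0 hB1
  have hcomm : π a * π b = π b * π a := by rw [← map_mul, hab, map_mul]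
  rw [← hΦ a, ← hΦ b] at hAB hBA
  have hsplit : Φ a * F - F * Φ a =
      ((ContinuousLinearMap.adjoint (D (π b))).comp (D (π a)) -
        (ContinuousLinearMap.adjoint (D (π a))).comp (D (π b))) -
      (Φ a * (Φ b - F) - (Φ b - F) * Φ a) := by
    simp only [hD, ← hΦ]
    rw [hAB, hBA, hcomm]
    noncomm_ring
  have hcomp {X Y : H →L[ℂ] M} : ‖(ContinuousLinearMap.adjoint X).comp Y‖ ≤ ‖X‖ * ‖Y‖ := by
    simpa using ContinuousLinearMap.opNorm_comp_le (ContinuousLinearMap.adjoint X) Y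
  have hunsharp : ‖Φ b - Φ b * Φ b‖ ≤ 2 * ‖Φ b - F‖ + ‖F - F * F‖ := by
    have hn1 : ‖1 - F‖ ≤ 1 := by
      refine (CStarAlgebra.norm_le_one_iff_of_nonneg _ (sub_nonneg.2 hF1)).2 ?_
      simpa using hF0
    have hn2 : ‖Φ b‖ ≤ 1 := (CStarAlgebra.norm_le_one_iff_of_nonneg _ hΦb0).2 hΦb1
    have heq : Φ b - Φ b * Φ b =
        ((Φ b - F) * (1 - F) - Φ b * (Φ b - F)) + (F - F * F) := by noncomm_ring
    have h1 := norm_add_le ((Φ b - F) * (1 - F) - Φ b * (Φ b - F)) (F - F * F)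
    have h2 := norm_sub_le ((Φ b - F) * (1 - F)) (Φ b * (Φ b - F))
    have h3 := (norm_mul_le (Φ b - F) (1 - F)).trans
      (mul_le_of_le_one_right (norm_nonneg _) hn1)
    have h4 := (norm_mul_le (Φ b) (Φ b - F)).trans
      (mul_le_of_le_one_left (norm_nonneg _) hn2)
    rw [heq]
    linarith
  have hprod : ‖D (π a)‖ * ‖D (π b)‖ ≤
      √‖Φ a - Φ a * Φ a‖ * √(2 * ‖Φ b - F‖ + ‖F - F * F‖) :=
    mul_le_mul hDa (hDb.trans (Real.sqrt_le_sqrt hunsharp)) (norm_nonneg _) (Real.sqrt_nonneg _)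
  have h1 := norm_commutator_le_of_effect hΦa0 hΦa1 (Φ b - F)
  have h2 := hcomp (X := D (π b)) (Y := D (π a))
  have h3 := hcomp (X := D (π a)) (Y := D (π b))
  rw [mul_comm] at h2
  rw [hsplit]
  refine (norm_sub_le _ _).trans ?_
  have h4 := norm_sub_le ((ContinuousLinearMap.adjoint (D (π b))).comp (D (π a)))
    ((ContinuousLinearMap.adjoint (D (π a))).comp (D (π b)))
  linarith
end
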